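/- arXiv:math/0512265 — 4 statements merged into one kernel-verified Lean document; each statement's English description precedes it below -/
import Mathlib

section
/- Let K and E be complex Hilbert spaces, U : K → E a linear isometry, e∘ ∈ E and e₊ ∈ ℂ with ‖e∘‖² = −2 Re e₊ (equivalently ⟪e∘, e∘⟫ + e₊ + conj e₊ = 0). Define S : ℂ × K × ℂ → ℂ × E × ℂ by S(x, v, y) := (x + ⟪e∘, U v⟫ + conj (e₊) * y, −(U v) + y • e∘, y). Then S is a pseudo-isometry for the Minkowski forms: η_E (S z, S z') = η_K (z, z') for all z, z' ∈ ℂ × K × ℂ. (This is the triangular pseudo-isometry of the Remark following Theorem 1, reducing any indefinite-metric representation of a conditionally positive function with cyclic zero-pseudo-norm vector e = (1, e∘, e₊) to the canonical form.) -/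
/-- The Minkowski (indefinite) form on `ℂ × K × ℂ` over a complex inner product space `K`:
`η((x,v,y),(x',v',y')) = conj x · y' + ⟪v, v'⟫ + conj y · x'`. -/
noncomputable def minkForm {K : Type*} [NormedAddCommGroup K] [InnerProductSpace ℂ K]
    (z w : ℂ × K × ℂ) : ℂ :=
  (starRingEnd ℂ) z.1 * w.2.2 + (inner ℂ z.2.1 w.2.1 : ℂ) + (starRingEnd ℂ) z.2.2 * w.1

/-- The triangular pseudo-isometry of the remark following Theorem 1: given a linear isometry
`U : K → E`, a vector `e∘ ∈ E` and `e₊ ∈ ℂ` with `‖e∘‖² = −2 Re e₊`, the map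
`S(x, v, y) = (x + ⟪e∘, U v⟫ + conj e₊ · y, −(U v) + y • e∘, y)` preserves the Minkowski
forms: `η_E (S z, S z') = η_K (z, z')`. -/
theorem triangular_pseudoIsometry {K E : Type*}
    [NormedAddCommGroup K] [InnerProductSpace ℂ K]
    [NormedAddCommGroup E] [InnerProductSpace ℂ E]
    (U : K →ₗᵢ[ℂ] E) (e0 : E) (ep : ℂ)
    (he : (‖e0‖ : ℝ) ^ 2 = -2 * ep.re)
    (S : ℂ × K × ℂ → ℂ × E × ℂ)
    (hS : ∀ (x : ℂ) (v : K) (y : ℂ),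
      S (x, v, y) =
        (x + (inner ℂ e0 (U v) : ℂ) + (starRingEnd ℂ) ep * y, -(U v) + y • e0, y)) :
    ∀ z z' : ℂ × K × ℂ, minkForm (S z) (S z') = minkForm z z' := by
  rintro ⟨x, v, y⟩ ⟨x', v', y'⟩
  have h : (inner ℂ e0 e0 : ℂ) + (ep + (starRingEnd ℂ) ep) = 0 := by
    rw [inner_self_eq_norm_sq_to_K, Complex.add_conj, RCLike.ofReal_eq_complex_ofReal,
      ← Complex.ofReal_pow, he]
    push_cast
    ring
  simp only [hS, minkForm, map_add, map_mul, inner_add_left, inner_add_right, inner_neg_left,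
    inner_neg_right, inner_smul_left, inner_smul_right, inner_conj_symm, Complex.conj_conj,
    LinearIsometry.inner_map_map]
  linear_combination (starRingEnd ℂ) y * y' * h
end

section
/- Let K be a complex Hilbert space, 𝕂 := ℂ × K × ℂ with the product Hilbert inner product, J(x, v, y) := (y, v, x), and let S be the bounded triangular operator with unit corner entries on 𝕂 determined by (f, μ, T, w): S(x, v, y) = (x + f v + μ * y, T v + y • w, y). Then (J ∘ S^* ∘ J) ∘ S = id (i.e. S is pseudo-isometric, S†S = 1) if and only if the following three conditions hold: T^* ∘ T = id_K, 2 Re μ + ‖w‖² = 0, and f v = −⟪w, T v⟫ for all v ∈ K. (These are the pseudo-isometry conditions (3.7) on the triangular generator matrices S(x) characterizing the isometry of the solutions of the quantum stochastic differential equation in Theorem 4.3.) -/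
/-- The product Hilbert inner product on `ℂ × K × ℂ`. -/
noncomputable def prodInner {K : Type*} [NormedAddCommGroup K] [InnerProductSpace ℂ K]
    (z w : ℂ × K × ℂ) : ℂ :=
  (starRingEnd ℂ) z.1 * w.1 + (inner ℂ z.2.1 w.2.1 : ℂ) + (starRingEnd ℂ) z.2.2 * w.2.2

/-- The unitary flip `J(x, v, y) = (y, v, x)` on `ℂ × K × ℂ`. -/
def Jflip {K : Type*} (z : ℂ × K × ℂ) : ℂ × K × ℂ := (z.2.2, z.2.1, z.1)

/-- The product inner product separates points. -/
theorem eq_of_forall_prodInner_eq {K : Type*} [NormedAddCommGroup K] [InnerProductSpace ℂ K]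
    {z z' : ℂ × K × ℂ} (h : ∀ u, prodInner z u = prodInner z' u) : z = z' := by
  obtain ⟨x, v, y⟩ := z
  obtain ⟨x', v', y'⟩ := z'
  have hx : x = x' := (starRingEnd ℂ).injective (by simpa [prodInner] using h (1, 0, 0))
  have hy : y = y' := (starRingEnd ℂ).injective (by simpa [prodInner] using h (0, 0, 1))
  have hv : v = v' := ext_inner_right ℂ fun u ↦ by simpa [prodInner] using h (0, u, 0)
  rw [hx, hy, hv]

/-- `S† ∘ S = id` says that `S` preserves the indefinite form `(z, u) ↦ ⟪J z, u⟫`. -/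
theorem pseudoConjugate_comp_eq_id_iff {K : Type*} [NormedAddCommGroup K] [InnerProductSpace ℂ K]
    {S Sstar : ℂ × K × ℂ → ℂ × K × ℂ}
    (hSstar : ∀ z z' : ℂ × K × ℂ, prodInner (Sstar z) z' = prodInner z (S z')) :
    (Jflip ∘ Sstar ∘ Jflip) ∘ S = id ↔
      ∀ z z', prodInner (Jflip (S z)) (S z') = prodInner (Jflip z) z' := by
  constructor
  · intro h z z'
    have hz : Jflip (Sstar (Jflip (S z))) = z := congrFun h z
    have hz' : Sstar (Jflip (S z)) = Jflip z := congrArg Jflip hz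
    rw [← hSstar, hz']
  · intro h
    funext z
    have hz : Sstar (Jflip (S z)) = Jflip z :=
      eq_of_forall_prodInner_eq fun u ↦ by rw [hSstar, h]
    exact congrArg Jflip hz

/-- The pseudo-isometry conditions (3.7): a triangular operator
`S(x,v,y) = (x + f v + μ·y, T v + y • w, y)` on `𝕂 = ℂ × K × ℂ` satisfies `S†S = 1`
(where `S† = J ∘ S^* ∘ J` with `S^*` the Hilbert adjoint for the product inner product)
if and only if `T^* ∘ T = id`, `2 Re μ + ‖w‖² = 0`, and `f v = −⟪w, T v⟫` for all `v`. -/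
theorem triangular_pseudoIsometry_iff {K : Type*}
    [NormedAddCommGroup K] [InnerProductSpace ℂ K] [CompleteSpace K]
    (f : K →L[ℂ] ℂ) (μ : ℂ) (T : K →L[ℂ] K) (w : K)
    (S Sstar : ℂ × K × ℂ → ℂ × K × ℂ)
    (hS : ∀ (x : ℂ) (v : K) (y : ℂ), S (x, v, y) = (x + f v + μ * y, T v + y • w, y))
    (hSstar : ∀ z z' : ℂ × K × ℂ, prodInner (Sstar z) z' = prodInner z (S z')) :
    ((Jflip ∘ Sstar ∘ Jflip) ∘ S = id) ↔
      ((ContinuousLinearMap.adjoint T).comp T = ContinuousLinearMap.id ℂ K ∧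
       2 * μ.re + ‖w‖ ^ 2 = 0 ∧
       ∀ v : K, f v = -(inner ℂ w (T v) : ℂ)) := by
  rw [pseudoConjugate_comp_eq_id_iff hSstar]
  have hμ : 2 * μ.re + ‖w‖ ^ 2 = 0 ↔ μ + inner ℂ w w + (starRingEnd ℂ) μ = 0 := by
    rw [add_right_comm, Complex.add_conj, inner_self_eq_norm_sq_to_K,
      RCLike.ofReal_eq_complex_ofReal]
    norm_cast
  have hT : (ContinuousLinearMap.adjoint T).comp T = ContinuousLinearMap.id ℂ K ↔
      ∀ v v' : K, (inner ℂ (T v) (T v') : ℂ) = inner ℂ v v' :=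
    (ContinuousLinearMap.inner_map_map_iff_adjoint_comp_self T).symm
  rw [hμ, hT]
  constructor
  · intro h
    refine ⟨fun v v' ↦ ?_, ?_, fun v ↦ ?_⟩
    · simpa [hS, prodInner, Jflip] using h (0, v, 0) (0, v', 0)
    · simpa [hS, prodInner, Jflip] using h (0, 0, 1) (0, 0, 1)
    · exact eq_neg_of_add_eq_zero_left
        (by simpa [hS, prodInner, Jflip] using h (0, 0, 1) (0, v, 0))
  · rintro ⟨hT, hμ, hf⟩ ⟨x, v, y⟩ ⟨x', v', y'⟩
    simp only [hS, prodInner, Jflip, hf, inner_add_left, inner_add_right, inner_smul_left,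
      inner_smul_right, hT, map_add, map_mul, map_neg, inner_conj_symm]
    linear_combination (starRingEnd ℂ) y * y' * hμ
end

section
/- Let M be a ⋆-monoid, K a complex inner product space, and suppose λ : M → ℂ and k : M → K are maps satisfying the coboundary identity λ (f * h) = λ f + λ h + ⟪k (star f), k h⟫ for all f, h ∈ M (inner product conjugate-linear in the first argument). Then λ is conditionally positive definite on M: for every finitely supported κ : M → ℂ with ∑_b κ b = 0, the sum ∑_{a,c} κ a * conj (κ c) * λ (a * star c) equals ‖∑_b conj (κ b) • k (star b)‖², hence is a nonnegative real number. (This is the implication (iii) ⇒ (ii) of Theorem 1: existence of a Hilbert-space decomposition k⋆(f) k(h) = λ(f·h) − λ(f) − λ(h) forces conditional positive definiteness of λ.) -/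
open Finset ComplexOrder

/-- Theorem 1, (iii) ⇒ (ii): if `l : M → ℂ` on a ⋆-monoid admits a Hilbert-space decomposition
`l (f * h) = l f + l h + ⟪k (star f), k h⟫`, then for every finitely supported `κ` with
`∑ κ b = 0` the double sum `∑∑ κ a · conj (κ c) · l (a ⋆ c)` equals
`‖∑ conj (κ b) • k (star b)‖²`, hence is a nonnegative real number. -/
theorem condPosDef_of_coboundary {M : Type*} [Monoid M] [StarMul M]
    {K : Type*} [NormedAddCommGroup K] [InnerProductSpace ℂ K]
    (l : M → ℂ) (k : M → K)
    (hco : ∀ f h : M, l (f * h) = l f + l h + (inner ℂ (k (star f)) (k h) : ℂ)) :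
    ∀ κ : M →₀ ℂ, (∑ b ∈ κ.support, κ b) = 0 →
      (∑ a ∈ κ.support, ∑ c ∈ κ.support,
          κ a * (starRingEnd ℂ) (κ c) * l (a * star c))
        = (‖∑ b ∈ κ.support, (starRingEnd ℂ) (κ b) • k (star b)‖ : ℂ) ^ 2 ∧
      0 ≤ ∑ a ∈ κ.support, ∑ c ∈ κ.support,
          κ a * (starRingEnd ℂ) (κ c) * l (a * star c) := by
  intro κ hκ
  have hκ' : ∑ c ∈ κ.support, (starRingEnd ℂ) (κ c) = 0 := by
    rw [← map_sum, hκ, map_zero]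
  have key : (∑ a ∈ κ.support, ∑ c ∈ κ.support, κ a * (starRingEnd ℂ) (κ c) * l (a * star c))
      = (‖∑ b ∈ κ.support, (starRingEnd ℂ) (κ b) • k (star b)‖ : ℂ) ^ 2 := by
    have hsplit : ∀ a c : M, κ a * (starRingEnd ℂ) (κ c) * l (a * star c)
        = κ a * l a * (starRingEnd ℂ) (κ c) + κ a * ((starRingEnd ℂ) (κ c) * l (star c))
          + inner ℂ ((starRingEnd ℂ) (κ a) • k (star a))
              ((starRingEnd ℂ) (κ c) • k (star c)) := by
      intro a c
      rw [hco, inner_smul_left, inner_smul_right, Complex.conj_conj]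
      ring
    have hnorm := inner_self_eq_norm_sq_to_K (𝕜 := ℂ)
      (∑ b ∈ κ.support, (starRingEnd ℂ) (κ b) • k (star b))
    simp only [sum_inner, inner_sum] at hnorm
    simp_rw [hsplit, sum_add_distrib, ← mul_sum, ← sum_mul, hκ, hκ']
    rw [mul_zero, zero_mul, zero_add, zero_add]
    rw [sum_comm]
    exact hnorm
  refine ⟨key, ?_⟩
  rw [key, ← Complex.ofReal_pow, Complex.zero_le_real]
  positivity
end

section
/- Let H be a complex inner product space equipped with an involutive map η ↦ η^# and let L : H → ℂ be an additive functional. On M := ℂ × H define the Hermitian (Gaussian) composition (α, ξ) ⋆ (γ, ζ) := (conj α + ⟪ξ, ζ⟫ + γ, ξ^# + ζ), with neutral element (0, 0), and set λ (β, η) := β + L η. Then λ is conditionally positive definite with respect to ⋆: for every finitely supported κ : M → ℂ with ∑_b κ b = 0, the sum ∑_{a,c} κ a * conj (κ c) * λ (a ⋆ c) equals ‖∑_b conj (κ b) • (b.2)‖², hence is a nonnegative real number. (This is the conditional positivity of the logarithmic functional λ_Δ(b) = [β + (η,θ)] μ_Δ of the Gaussian chaotic state in the Gaussian-state Example of Chapter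 I.) -/
open Finset ComplexOrder

/-- The Gaussian composition `(α, ξ) ⋆ (γ, ζ) = (conj α + ⟪ξ, ζ⟫ + γ, ξ^# + ζ)` on `ℂ × H`. -/
noncomputable def gaussComp {H : Type*} [NormedAddCommGroup H] [InnerProductSpace ℂ H]
    (sharp : H → H) (a c : ℂ × H) : ℂ × H :=
  ((starRingEnd ℂ) a.1 + (inner ℂ a.2 c.2 : ℂ) + c.1, sharp a.2 + c.2)

/-- Conditional positivity of the logarithmic functional of the Gaussian chaotic state: for
`λ (β, η) = β + L η` with `L` additive and an involution `η ↦ η^#` on `H`, and any finitely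
supported `κ : ℂ × H → ℂ` with `∑ κ b = 0`, the double sum `∑∑ κ a · conj (κ c) · λ (a ⋆ c)`
equals `‖∑ conj (κ b) • b.2‖²`, hence is a nonnegative real number. -/
theorem gaussian_condPosDef {H : Type*} [NormedAddCommGroup H] [InnerProductSpace ℂ H]
    (sharp : H → H) (hsharp : Function.Involutive sharp)
    (L : H → ℂ) (hL : ∀ ξ ζ : H, L (ξ + ζ) = L ξ + L ζ) :
    ∀ κ : (ℂ × H) →₀ ℂ, (∑ b ∈ κ.support, κ b) = 0 →
      (∑ a ∈ κ.support, ∑ c ∈ κ.support,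
          κ a * (starRingEnd ℂ) (κ c) *
            ((gaussComp sharp a c).1 + L (gaussComp sharp a c).2))
        = (‖∑ b ∈ κ.support, (starRingEnd ℂ) (κ b) • b.2‖ : ℂ) ^ 2 ∧
      0 ≤ ∑ a ∈ κ.support, ∑ c ∈ κ.support,
          κ a * (starRingEnd ℂ) (κ c) *
            ((gaussComp sharp a c).1 + L (gaussComp sharp a c).2) := by
  intro κ hκ
  have hconj : ∑ c ∈ κ.support, (starRingEnd ℂ) (κ c) = 0 := by
    rw [← map_sum, hκ, map_zero]
  have hsum : (∑ a ∈ κ.support, ∑ c ∈ κ.support,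
      κ a * (starRingEnd ℂ) (κ c) *
        ((gaussComp sharp a c).1 + L (gaussComp sharp a c).2))
      = (‖∑ b ∈ κ.support, (starRingEnd ℂ) (κ b) • b.2‖ : ℂ) ^ 2 := by
    have hsplit : ∀ a c : ℂ × H, κ a * (starRingEnd ℂ) (κ c) *
        ((gaussComp sharp a c).1 + L (gaussComp sharp a c).2)
        = κ a * ((starRingEnd ℂ) a.1 + L (sharp a.2)) * (starRingEnd ℂ) (κ c)
          + κ a * ((starRingEnd ℂ) (κ c) * (c.1 + L c.2))
          + inner ℂ ((starRingEnd ℂ) (κ a) • a.2) ((starRingEnd ℂ) (κ c) • c.2) := by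
      intro a c
      simp only [gaussComp, hL, inner_smul_left, inner_smul_right, Complex.conj_conj]
      ring
    simp only [hsplit, sum_add_distrib, ← mul_sum, ← sum_mul, hκ, hconj, mul_zero, zero_mul,
      zero_add, ← inner_sum, ← sum_inner]
    exact inner_self_eq_norm_sq_to_K _
  refine ⟨hsum, ?_⟩
  rw [hsum]
  exact_mod_cast sq_nonneg ‖∑ b ∈ κ.support, (starRingEnd ℂ) (κ b) • b.2‖
end
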